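/- Twisted column exchange relations in rank one: for N = 1, define the 3x3 matrices Gamma_0(z) = diag(1, (x-z)/(x-q^2 z), (x-z)(x-qz)/((x-q^2 z)(x-q^3 z))), Gamma_1(z) = ((1-q^2) z/(x-q^2 z)) * E_{21} + (q(1-q)^2(1+q)(x-z) z/((x-q^2 z)(x-q^3 z))) * E_{32}, and Gamma_2(z) = ((1-q^2)(x+q^2 x-q^2 z-q^3 z) z/((x-q^2 z)(x-q^3 z))) * E_{31}, where E_{ab} denotes the 3x3 elementary matrix with 1 in row a, column b. Then for all k, l in {0,1,2}, Gamma_k(z) * Gamma_l(y) = sum over i,j in {0,1,2} of W_{z/y}(i,j;k,l) * Gamma_j(y) * Gamma_i(z), where W_{z/y}(i,j;k,l) are the Izergin-Korepin nineteen-vertex weights with horizontal parameter y and vertical parameter z, provided all denominators x-q^2 z, x-q^3 z, x-q^2 y, x-q^3 y, y-q^2 z, y-q^3 z are nonzero. -/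

import Mathlib

/-- The nineteen weights of the Izergin--Korepin nineteen-vertex model, with
horizontal spectral parameter `x` and vertical spectral parameter `y`. -/
def W19 {F : Type*} [Field F] (q x y : F) (i j k l : Fin 3) : F :=
  if (i, j, k, l) = (0, 0, 0, 0) then 1
  else if (i, j, k, l) = (1, 0, 1, 0) then q ^ 2 * (x - y) / (x - q ^ 2 * y)
  else if (i, j, k, l) = (1, 0, 0, 1) then (1 - q ^ 2) * x / (x - q ^ 2 * y)
  else if (i, j, k, l) = (2, 0, 2, 0) then
    q ^ 4 * (x - y) * (x - q * y) / ((x - q ^ 2 * y) * (x - q ^ 3 * y))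
  else if (i, j, k, l) = (2, 0, 1, 1) then
    -(q * (1 - q) ^ 2 * (1 + q) * x * (x - y)) / ((x - q ^ 2 * y) * (x - q ^ 3 * y))
  else if (i, j, k, l) = (2, 0, 0, 2) then
    (1 - q ^ 2) * x * (x + q * x - q * y - q ^ 3 * y) / ((x - q ^ 2 * y) * (x - q ^ 3 * y))
  else if (i, j, k, l) = (0, 1, 1, 0) then (1 - q ^ 2) * y / (x - q ^ 2 * y)
  else if (i, j, k, l) = (0, 1, 0, 1) then (x - y) / (x - q ^ 2 * y)
  else if (i, j, k, l) = (1, 1, 2, 0) then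
    -(q ^ 4 * (1 + q) * (x - y) * y) / ((x - q ^ 2 * y) * (x - q ^ 3 * y))
  else if (i, j, k, l) = (1, 1, 1, 1) then
    (-(q * x ^ 2) + (1 + q) * (1 - q ^ 2 + q ^ 4) * x * y - q ^ 4 * y ^ 2) /
      ((x - q ^ 2 * y) * (x - q ^ 3 * y))
  else if (i, j, k, l) = (1, 1, 0, 2) then
    (1 + q) * x * (x - y) / ((x - q ^ 2 * y) * (x - q ^ 3 * y))
  else if (i, j, k, l) = (2, 1, 2, 1) then q ^ 2 * (x - y) / (x - q ^ 2 * y)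
  else if (i, j, k, l) = (2, 1, 1, 2) then (1 - q ^ 2) * x / (x - q ^ 2 * y)
  else if (i, j, k, l) = (0, 2, 2, 0) then
    (1 - q ^ 2) * (x + q ^ 2 * x - q ^ 2 * y - q ^ 3 * y) * y /
      ((x - q ^ 2 * y) * (x - q ^ 3 * y))
  else if (i, j, k, l) = (0, 2, 1, 1) then
    q * (1 - q) ^ 2 * (1 + q) * (x - y) * y / ((x - q ^ 2 * y) * (x - q ^ 3 * y))
  else if (i, j, k, l) = (0, 2, 0, 2) then
    (x - y) * (x - q * y) / ((x - q ^ 2 * y) * (x - q ^ 3 * y))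
  else if (i, j, k, l) = (1, 2, 2, 1) then (1 - q ^ 2) * y / (x - q ^ 2 * y)
  else if (i, j, k, l) = (1, 2, 1, 2) then (x - y) / (x - q ^ 2 * y)
  else if (i, j, k, l) = (2, 2, 2, 2) then 1
  else 0

/-- The rank-one twisted column operators `Γ_0, Γ_1, Γ_2` of the
Izergin--Korepin model, as `3 × 3` matrices depending on the parameter `x`. -/
def Gam {F : Type*} [Field F] (q x : F) (k : Fin 3) (z : F) :
    Matrix (Fin 3) (Fin 3) F :=
  if k = 0 then
    Matrix.diagonal
      ![1, (x - z) / (x - q ^ 2 * z),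
        (x - z) * (x - q * z) / ((x - q ^ 2 * z) * (x - q ^ 3 * z))]
  else if k = 1 then
    Matrix.of
      !![0, 0, 0;
         (1 - q ^ 2) * z / (x - q ^ 2 * z), 0, 0;
         0, q * (1 - q) ^ 2 * (1 + q) * (x - z) * z /
             ((x - q ^ 2 * z) * (x - q ^ 3 * z)), 0]
  else
    Matrix.of
      !![0, 0, 0;
         0, 0, 0;
         (1 - q ^ 2) * (x + q ^ 2 * x - q ^ 2 * z - q ^ 3 * z) * z /
             ((x - q ^ 2 * z) * (x - q ^ 3 * z)), 0, 0]

/-- `Γ_0` written out entrywise. -/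
lemma Gam_zero_eq {F : Type*} [Field F] (q x z : F) :
    Gam q x 0 z = !![1, 0, 0; 0, (x - z) / (x - q ^ 2 * z), 0;
      0, 0, (x - z) * (x - q * z) / ((x - q ^ 2 * z) * (x - q ^ 3 * z))] := by
  ext a b
  fin_cases a <;> fin_cases b <;> simp [Gam, Matrix.diagonal]

/-- `Γ_1` written out entrywise. -/
lemma Gam_one_eq {F : Type*} [Field F] (q x z : F) :
    Gam q x 1 z = !![0, 0, 0; (1 - q ^ 2) * z / (x - q ^ 2 * z), 0, 0;
      0, q * (1 - q) ^ 2 * (1 + q) * (x - z) * z /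
        ((x - q ^ 2 * z) * (x - q ^ 3 * z)), 0] := rfl

/-- `Γ_2` written out entrywise. -/
lemma Gam_two_eq {F : Type*} [Field F] (q x z : F) :
    Gam q x 2 z = !![0, 0, 0; 0, 0, 0;
      (1 - q ^ 2) * (x + q ^ 2 * x - q ^ 2 * z - q ^ 3 * z) * z /
        ((x - q ^ 2 * z) * (x - q ^ 3 * z)), 0, 0] := rfl

set_option maxHeartbeats 8000000 in
/-- Twisted column exchange relations in rank one:
`Γ_k(z) Γ_l(y) = ∑_{i,j} W_{z/y}(i,j;k,l) Γ_j(y) Γ_i(z)`. -/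
theorem rank_one_twisted_exchange {F : Type*} [Field F] (q x y z : F)
    (hxz2 : x - q ^ 2 * z ≠ 0) (hxz3 : x - q ^ 3 * z ≠ 0)
    (hxy2 : x - q ^ 2 * y ≠ 0) (hxy3 : x - q ^ 3 * y ≠ 0)
    (hyz2 : y - q ^ 2 * z ≠ 0) (hyz3 : y - q ^ 3 * z ≠ 0)
    (k l : Fin 3) :
    Gam q x k z * Gam q x l y =
      ∑ i : Fin 3, ∑ j : Fin 3, W19 q y z i j k l • (Gam q x j y * Gam q x i z) := by
  have hxz2 : x - z * q ^ 2 ≠ 0 := by rwa [mul_comm]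
  have hxz3 : x - z * q ^ 3 ≠ 0 := by rwa [mul_comm]
  have hxy2 : x - y * q ^ 2 ≠ 0 := by rwa [mul_comm]
  have hxy3 : x - y * q ^ 3 ≠ 0 := by rwa [mul_comm]
  have hyz2 : y - z * q ^ 2 ≠ 0 := by rwa [mul_comm]
  have hyz3 : y - z * q ^ 3 ≠ 0 := by rwa [mul_comm]
  fin_cases k <;> fin_cases l <;>
    simp [W19, Fin.sum_univ_three, Gam_zero_eq, Gam_one_eq, Gam_two_eq] <;>
    (try refine ⟨?_, ?_⟩) <;> (try refine ⟨?_, ?_⟩) <;>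
    first
    | (field_simp; done)
    | (field_simp; ring)
    | (ext c; fin_cases c <;> rfl)
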